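/- arXiv:2107.04672 — 10 statements merged into one kernel-verified Lean document; each statement's English description precedes it below -/
import Mathlib

section
/- Let A and B be real symmetric positive definite n×n matrices, let d₁ ≥ 0 and d₂ ≥ 0 be real scalars such that A - d₂B is positive definite, and let ‖·‖_ν be a monotone norm on real n×n matrices. If κ_ν(B) ≤ κ_ν(A), then κ_ν(A + d₁B) ≤ κ_ν(A - d₂B). -/
open Matrix in
/-- A weighted form of the operator convexity of the inverse on positive definite matrices. -/
theorem Matrix.PosDef.posSemidef_weighted_inv_sub_inv_add {n : ℕ}
    {A B : Matrix (Fin n) (Fin n) ℝ} (hA : A.PosDef) (hB : B.PosDef)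
    {d α β : ℝ} (hd : 0 ≤ d) (hαβ : α + d * β = 1) :
    ((α ^ 2) • A⁻¹ + (d * β ^ 2) • B⁻¹ - (A + d • B)⁻¹).PosSemidef := by
  have hS : (A + d • B).PosDef := hA.add_posSemidef (hB.posSemidef.smul hd)
  set T := (A + d • B)⁻¹ with hT
  have hAu : IsUnit A.det := (isUnit_iff_isUnit_det A).1 hA.isUnit
  have hBu : IsUnit B.det := (isUnit_iff_isUnit_det B).1 hB.isUnit
  have hSu : IsUnit (A + d • B).det := (isUnit_iff_isUnit_det _).1 hS.isUnit
  have hP : (α • A⁻¹ - T)ᴴ = α • A⁻¹ - T := by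
    rw [conjTranspose_sub, conjTranspose_smul, hA.inv.isHermitian.eq, hS.inv.isHermitian.eq,
      star_trivial]
  have hQ : (β • B⁻¹ - T)ᴴ = β • B⁻¹ - T := by
    rw [conjTranspose_sub, conjTranspose_smul, hB.inv.isHermitian.eq, hS.inv.isHermitian.eq,
      star_trivial]
  have expand (M : Matrix (Fin n) (Fin n) ℝ) (hM : IsUnit M.det) (c : ℝ) :
      (c • M⁻¹ - T) * M * (c • M⁻¹ - T) = (c ^ 2) • M⁻¹ - (2 * c) • T + T * M * T := by
    simp only [sub_mul, mul_sub, smul_mul_assoc, mul_smul_comm, nonsing_inv_mul _ hM,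
      mul_nonsing_inv_cancel_right _ _ hM, one_mul]
    module
  have hTST : T * A * T + d • (T * B * T) = T := by
    have h : T * (A + d • B) * T = T := by rw [hT, nonsing_inv_mul _ hSu, one_mul]
    simpa only [mul_add, add_mul, mul_smul_comm, smul_mul_assoc] using h
  have key : (α ^ 2) • A⁻¹ + (d * β ^ 2) • B⁻¹ - T =
      (α • A⁻¹ - T)ᴴ * A * (α • A⁻¹ - T) + d • ((β • B⁻¹ - T)ᴴ * B * (β • B⁻¹ - T)) := by
    rw [hP, hQ, expand A hAu, expand B hBu]
    have hα : α = 1 - d * β := by linarith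
    calc (α ^ 2) • A⁻¹ + (d * β ^ 2) • B⁻¹ - T
        = (α ^ 2) • A⁻¹ + (d * β ^ 2) • B⁻¹ - (2 * (α + d * β)) • T + T := by
          rw [hαβ]; module
      _ = (α ^ 2) • A⁻¹ + (d * β ^ 2) • B⁻¹ - (2 * (α + d * β)) • T
          + (T * A * T + d • (T * B * T)) := by rw [hTST]
      _ = _ := by module
  rw [key]
  exact (hA.posSemidef.conjTranspose_mul_mul_same _).add
    ((hB.posSemidef.conjTranspose_mul_mul_same _).smul hd)

/-- The condition number of `A + d • B` is at most a weighted mean of those of `A` and `B`. -/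
theorem condition_number_add_smul_mul_le {n : ℕ} {ν : Matrix (Fin n) (Fin n) ℝ → ℝ}
    (hν_nonneg : ∀ M, 0 ≤ ν M)
    (hν_homog : ∀ (c : ℝ) M, ν (c • M) = |c| * ν M)
    (hν_tri : ∀ M N, ν (M + N) ≤ ν M + ν N)
    (hν_mono : ∀ M N : Matrix (Fin n) (Fin n) ℝ,
      M.PosSemidef → (N - M).PosSemidef → ν M ≤ ν N)
    {A B : Matrix (Fin n) (Fin n) ℝ} (hA : A.PosDef) (hB : B.PosDef)
    {d : ℝ} (hd : 0 ≤ d) (hB_pos : 0 < ν B⁻¹) :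
    ν (A + d • B) * ν (A + d • B)⁻¹ * (ν B⁻¹ + d * ν A⁻¹) ≤
      ν A * ν A⁻¹ * ν B⁻¹ + d * (ν B * ν B⁻¹) * ν A⁻¹ := by
  have hS : (A + d • B).PosDef := hA.add_posSemidef (hB.posSemidef.smul hd)
  have hA_nonneg := hν_nonneg A⁻¹
  have hs : 0 < ν B⁻¹ + d * ν A⁻¹ := by positivity
  set s := ν B⁻¹ + d * ν A⁻¹ with hs_def
  have hadd : ν (A + d • B) ≤ ν A + d * ν B := by
    simpa only [hν_homog, abs_of_nonneg hd] using hν_tri A (d • B)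
  have hinv : ν (A + d • B)⁻¹ * s ≤ ν A⁻¹ * ν B⁻¹ := by
    have hαβ : ν B⁻¹ / s + d * (ν A⁻¹ / s) = 1 := by
      field_simp
      exact hs_def.symm
    have h := (hν_mono _ _ hS.inv.posSemidef
      (hA.posSemidef_weighted_inv_sub_inv_add hB hd hαβ)).trans (hν_tri _ _)
    rw [hν_homog, hν_homog, abs_of_nonneg (sq_nonneg _),
      abs_of_nonneg (mul_nonneg hd (sq_nonneg _))] at h
    rw [← le_div_iff₀ hs]
    refine h.trans_eq ?_
    calc (ν B⁻¹ / s) ^ 2 * ν A⁻¹ + d * (ν A⁻¹ / s) ^ 2 * ν B⁻¹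
        = ν A⁻¹ * ν B⁻¹ / s * (ν B⁻¹ / s + d * (ν A⁻¹ / s)) := by ring
      _ = ν A⁻¹ * ν B⁻¹ / s := by rw [hαβ, mul_one]
  calc ν (A + d • B) * ν (A + d • B)⁻¹ * s
      = ν (A + d • B) * (ν (A + d • B)⁻¹ * s) := mul_assoc _ _ _
    _ ≤ (ν A + d * ν B) * (ν A⁻¹ * ν B⁻¹) :=
      mul_le_mul hadd hinv (mul_nonneg (hν_nonneg _) hs.le) ((hν_nonneg _).trans hadd)
    _ = _ := by ring

/-- Paper's Lemma A.3, first part: for a monotone matrix norm `ν`, symmetric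
positive definite `A, B`, and scalars `d₁, d₂ ≥ 0` with `A - d₂ B` positive
definite, if `κ_ν(B) ≤ κ_ν(A)` then `κ_ν(A + d₁ B) ≤ κ_ν(A - d₂ B)`, where
`κ_ν(M) = ν M * ν M⁻¹` is the condition number. -/
theorem condition_number_monotone_norm_le
    {n : ℕ} (ν : Matrix (Fin n) (Fin n) ℝ → ℝ)
    -- `ν` is a norm:
    (hν_nonneg : ∀ M, 0 ≤ ν M)
    (hν_def : ∀ M, ν M = 0 → M = 0)
    (hν_homog : ∀ (c : ℝ) M, ν (c • M) = |c| * ν M)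
    (hν_tri : ∀ M N, ν (M + N) ≤ ν M + ν N)
    -- `ν` is monotone: `0 ≤ B ≤ A` (Loewner order) implies `ν B ≤ ν A`:
    (hν_mono : ∀ M N : Matrix (Fin n) (Fin n) ℝ,
      M.PosSemidef → (N - M).PosSemidef → ν M ≤ ν N)
    (A B : Matrix (Fin n) (Fin n) ℝ)
    (hA : A.PosDef) (hB : B.PosDef)
    (d₁ d₂ : ℝ) (hd₁ : 0 ≤ d₁) (hd₂ : 0 ≤ d₂)
    (hC : (A - d₂ • B).PosDef)
    (hκ : ν B * ν B⁻¹ ≤ ν A * ν A⁻¹) :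
    ν (A + d₁ • B) * ν (A + d₁ • B)⁻¹ ≤ ν (A - d₂ • B) * ν (A - d₂ • B)⁻¹ := by
  rcases isEmpty_or_nonempty (Fin n) with hn | hn
  · rw [Subsingleton.elim (A + d₁ • B) (A - d₂ • B)]
  have hB_pos : 0 < ν B⁻¹ := by
    refine (hν_nonneg _).lt_of_ne fun h => ?_
    have h0 := hB.inv.isUnit
    rw [hν_def _ h.symm] at h0
    exact not_isUnit_zero h0
  have hA_nonneg := hν_nonneg A⁻¹
  have hC_nonneg := hν_nonneg (A - d₂ • B)⁻¹
  have hadd := condition_number_add_smul_mul_le hν_nonneg hν_homog hν_tri hν_mono hA hB hd₁ hB_pos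
  have hsub := condition_number_add_smul_mul_le hν_nonneg hν_homog hν_tri hν_mono hC hB hd₂ hB_pos
  rw [sub_add_cancel] at hsub
  calc ν (A + d₁ • B) * ν (A + d₁ • B)⁻¹
      ≤ ν A * ν A⁻¹ := by
        have hs : 0 < ν B⁻¹ + d₁ * ν A⁻¹ := by positivity
        refine le_of_mul_le_mul_right (hadd.trans ?_) hs
        linarith [mul_le_mul_of_nonneg_right hκ (mul_nonneg hd₁ hA_nonneg)]
    _ ≤ ν (A - d₂ • B) * ν (A - d₂ • B)⁻¹ := by
        refine le_of_mul_le_mul_right ?_ hB_pos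
        linarith [mul_le_mul_of_nonneg_right hκ (mul_nonneg hd₂ hC_nonneg)]
end

section
/- Let A and B be real symmetric positive definite n×n matrices, let d₁ ≥ 0 and d₂ ≥ 0 be real scalars with d₁ + d₂ > 0 such that A - d₂B is positive definite, and let ‖·‖_ν be a monotone norm on real n×n matrices. If κ_ν(B) < κ_ν(A), then κ_ν(A + d₁B) < κ_ν(A - d₂B). -/
open Matrix in
/-- A weighted form of the operator convexity of matrix inversion: for `a + b = 1`,
`(C + D)⁻¹ ≤ a² C⁻¹ + b² D⁻¹` in the Loewner order. -/
theorem Matrix.PosDef.posSemidef_sq_smul_inv_add_sub_inv_add {m : Type*} [Fintype m]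
    [DecidableEq m] {C D : Matrix m m ℝ} (hC : C.PosDef) (hD : D.PosDef) {a b : ℝ}
    (hab : a + b = 1) :
    (a ^ 2 • C⁻¹ + b ^ 2 • D⁻¹ - (C + D)⁻¹).PosSemidef := by
  set S := (C + D)⁻¹ with hS
  have hS_herm : Sᴴ = S := (hC.add hD).isHermitian.inv
  have hC_herm : (C⁻¹)ᴴ = C⁻¹ := hC.isHermitian.inv
  have hD_herm : (D⁻¹)ᴴ = D⁻¹ := hD.isHermitian.inv
  have hCu : IsUnit C.det := (isUnit_iff_isUnit_det C).1 hC.isUnit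
  have hDu : IsUnit D.det := (isUnit_iff_isUnit_det D).1 hD.isUnit
  have hSu : IsUnit (C + D).det := (isUnit_iff_isUnit_det _).1 (hC.add hD).isUnit
  have hSS : S * C * S + S * D * S = S := by
    rw [← Matrix.add_mul, ← Matrix.mul_add, hS, nonsing_inv_mul _ hSu, Matrix.one_mul]
  have expand : ∀ (E : Matrix m m ℝ) (r : ℝ), IsUnit E.det →
      (r • E⁻¹ - S) * E * (r • E⁻¹ - S) = r ^ 2 • E⁻¹ - (2 * r) • S + S * E * S := by
    intro E r hE
    rw [Matrix.sub_mul, Matrix.smul_mul, nonsing_inv_mul _ hE, Matrix.mul_sub, Matrix.sub_mul,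
      Matrix.mul_smul (S * E), Matrix.mul_assoc S E E⁻¹, mul_nonsing_inv _ hE]
    simp only [Matrix.sub_mul, Matrix.smul_mul, Matrix.one_mul, Matrix.mul_one]
    module
  have hsum : a ^ 2 • C⁻¹ + b ^ 2 • D⁻¹ - S =
      (a • C⁻¹ - S) * C * (a • C⁻¹ - S) + (b • D⁻¹ - S) * D * (b • D⁻¹ - S) := by
    obtain rfl : b = 1 - a := by linarith
    rw [expand C a hCu, expand D _ hDu]
    calc _ = a ^ 2 • C⁻¹ + (1 - a) ^ 2 • D⁻¹ - (2 : ℝ) • S + S := by module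
      _ = a ^ 2 • C⁻¹ + (1 - a) ^ 2 • D⁻¹ - (2 : ℝ) • S + (S * C * S + S * D * S) := by rw [hSS]
      _ = _ := by module
  rw [hsum]
  refine PosSemidef.add ?_ ?_
  · have h := hC.posSemidef.mul_mul_conjTranspose_same (a • C⁻¹ - S)
    rwa [conjTranspose_sub, conjTranspose_smul, star_trivial, hC_herm, hS_herm] at h
  · have h := hD.posSemidef.mul_mul_conjTranspose_same (b • D⁻¹ - S)
    rwa [conjTranspose_sub, conjTranspose_smul, star_trivial, hD_herm, hS_herm] at h

/-- The condition number of a sum is at most the average of the condition numbers, weighted by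
the norms of the summands. -/
theorem condition_number_add_mul_le {m : Type*} [Fintype m] [DecidableEq m]
    {ν : Matrix m m ℝ → ℝ}
    (hν_nonneg : ∀ M, 0 ≤ ν M)
    (hν_homog : ∀ (c : ℝ) M, ν (c • M) = |c| * ν M)
    (hν_tri : ∀ M N, ν (M + N) ≤ ν M + ν N)
    (hν_mono : ∀ M N : Matrix m m ℝ, M.PosSemidef → (N - M).PosSemidef → ν M ≤ ν N)
    {C D : Matrix m m ℝ} (hC : C.PosDef) (hD : D.PosDef) (hpos : 0 < ν C + ν D) :
    ν (C + D) * ν (C + D)⁻¹ * (ν C + ν D) ≤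
      ν C * (ν C * ν C⁻¹) + ν D * (ν D * ν D⁻¹) := by
  set a := ν C / (ν C + ν D) with ha
  set b := ν D / (ν C + ν D) with hb
  have hab : a + b = 1 := by rw [ha, hb, ← add_div, div_self hpos.ne']
  have hinv : ν (C + D)⁻¹ ≤ a ^ 2 * ν C⁻¹ + b ^ 2 * ν D⁻¹ := by
    calc ν (C + D)⁻¹ ≤ ν (a ^ 2 • C⁻¹ + b ^ 2 • D⁻¹) :=
          hν_mono _ _ (hC.add hD).inv.posSemidef
            (hC.posSemidef_sq_smul_inv_add_sub_inv_add hD hab)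
      _ ≤ ν (a ^ 2 • C⁻¹) + ν (b ^ 2 • D⁻¹) := hν_tri _ _
      _ = a ^ 2 * ν C⁻¹ + b ^ 2 * ν D⁻¹ := by simp only [hν_homog, abs_sq]
  calc ν (C + D) * ν (C + D)⁻¹ * (ν C + ν D)
      ≤ (ν C + ν D) * (a ^ 2 * ν C⁻¹ + b ^ 2 * ν D⁻¹) * (ν C + ν D) := by
        gcongr
        · exact hν_nonneg _
        · exact hν_tri _ _
    _ = _ := by
        rw [ha, hb]
        field_simp

/-- Paper's Lemma A.3, strict-inequality part: for a monotone matrix norm `ν`, symmetric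
positive definite `A, B`, and scalars `d₁, d₂ ≥ 0` with `A - d₂ B` positive
definite, with `d₁ + d₂ > 0`, if `κ_ν(B) < κ_ν(A)` then `κ_ν(A + d₁ B) < κ_ν(A - d₂ B)`, where
`κ_ν(M) = ν M * ν M⁻¹` is the condition number. -/
theorem condition_number_monotone_norm_lt
    {n : ℕ} (ν : Matrix (Fin n) (Fin n) ℝ → ℝ)
    -- `ν` is a norm:
    (hν_nonneg : ∀ M, 0 ≤ ν M)
    (hν_def : ∀ M, ν M = 0 → M = 0)
    (hν_homog : ∀ (c : ℝ) M, ν (c • M) = |c| * ν M)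
    (hν_tri : ∀ M N, ν (M + N) ≤ ν M + ν N)
    -- `ν` is monotone: `0 ≤ B ≤ A` (Loewner order) implies `ν B ≤ ν A`:
    (hν_mono : ∀ M N : Matrix (Fin n) (Fin n) ℝ,
      M.PosSemidef → (N - M).PosSemidef → ν M ≤ ν N)
    (A B : Matrix (Fin n) (Fin n) ℝ)
    (hA : A.PosDef) (hB : B.PosDef)
    (d₁ d₂ : ℝ) (hd₁ : 0 ≤ d₁) (hd₂ : 0 ≤ d₂) (hd : 0 < d₁ + d₂)
    (hC : (A - d₂ • B).PosDef)
    (hκ : ν B * ν B⁻¹ < ν A * ν A⁻¹) :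
    ν (A + d₁ • B) * ν (A + d₁ • B)⁻¹ < ν (A - d₂ • B) * ν (A - d₂ • B)⁻¹ := by
  have : Nonempty (Fin n) := by
    by_contra h
    rw [not_nonempty_iff] at h
    rw [Subsingleton.elim A B] at hκ
    exact lt_irrefl _ hκ
  have hpos : ∀ {M : Matrix (Fin n) (Fin n) ℝ}, M.PosDef → 0 < ν M := fun {M} hM =>
    (hν_nonneg M).lt_of_ne fun h => hM.isUnit.ne_zero (hν_def M h.symm)
  have hκ_smul : ∀ {t : ℝ}, 0 < t → ν (t • B) * ν (t • B)⁻¹ = ν B * ν B⁻¹ := by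
    intro t ht
    have hinv : (t • B)⁻¹ = t⁻¹ • B⁻¹ := by
      have hBu := (Matrix.isUnit_iff_isUnit_det B).1 hB.isUnit
      refine Matrix.inv_eq_left_inv ?_
      rw [Matrix.smul_mul, Matrix.mul_smul, smul_smul, inv_mul_cancel₀ ht.ne', one_smul,
        Matrix.nonsing_inv_mul _ hBu]
    rw [hinv, hν_homog, hν_homog, abs_of_pos ht, abs_of_pos (inv_pos.2 ht)]
    field_simp
  have hadd : ∀ {C : Matrix (Fin n) (Fin n) ℝ} {t : ℝ}, C.PosDef → 0 < t →
      0 < ν (t • B) ∧ ν (C + t • B) * ν (C + t • B)⁻¹ * (ν C + ν (t • B)) ≤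
        ν C * (ν C * ν C⁻¹) + ν (t • B) * (ν B * ν B⁻¹) := by
    intro C t hC ht
    have htB : (t • B).PosDef := hB.smul ht
    refine ⟨hpos htB, ?_⟩
    rw [← hκ_smul ht]
    exact condition_number_add_mul_le hν_nonneg hν_homog hν_tri hν_mono hC htB
      (add_pos (hpos hC) (hpos htB))
  have hlt_right : 0 < d₁ → ν (A + d₁ • B) * ν (A + d₁ • B)⁻¹ < ν A * ν A⁻¹ := by
    intro h
    obtain ⟨hb, hle⟩ := hadd hA h
    have := mul_lt_mul_of_pos_left hκ hb
    refine lt_of_mul_lt_mul_right (a := ν A + ν (d₁ • B)) ?_ (add_pos (hpos hA) hb).le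
    linarith
  have hlt_left : 0 < d₂ → ν A * ν A⁻¹ < ν (A - d₂ • B) * ν (A - d₂ • B)⁻¹ := by
    intro h
    obtain ⟨hb, hle⟩ := hadd hC h
    rw [sub_add_cancel] at hle
    have := mul_lt_mul_of_pos_left hκ hb
    refine lt_of_mul_lt_mul_left (a := ν (A - d₂ • B)) ?_ (hpos hC).le
    linarith
  rcases hd₁.eq_or_lt with rfl | h₁
  · simpa using hlt_left (by linarith)
  · rcases hd₂.eq_or_lt with rfl | h₂
    · simpa using hlt_right h₁
    · exact (hlt_right h₁).trans (hlt_left h₂)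
end

section
/- Let A and B be real symmetric positive definite n×n matrices, let d₂ > 0 be a real scalar such that C := A - d₂B is positive definite, and let ‖·‖_ν be a monotone norm on real n×n matrices. If κ_ν(B) ≤ κ_ν(A), then κ_ν(B) ≤ κ_ν(C). -/
open Matrix in
/-- Matrix form of completing the square: for symmetric `A` and `C`, the congruence of `C⁻¹`
by `t - C A⁻¹` expands as a quadratic in `t`. -/
theorem Matrix.PosDef.posSemidef_smul_inv_add {n : Type*} [Fintype n] [DecidableEq n]
    {A C : Matrix n n ℝ} (hA : A.PosDef) (hC : C.PosDef) (t : ℝ) :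
    (t ^ 2 • C⁻¹ - (2 * t) • A⁻¹ + A⁻¹ * C * A⁻¹).PosSemidef := by
  have hC_unit : IsUnit C.det := (Matrix.isUnit_iff_isUnit_det _).mp hC.isUnit
  have key := hC.inv.posSemidef.conjTranspose_mul_mul_same (t • (1 : Matrix n n ℝ) - C * A⁻¹)
  have hadj : (t • (1 : Matrix n n ℝ) - C * A⁻¹)ᴴ = t • (1 : Matrix n n ℝ) - A⁻¹ * C := by
    rw [conjTranspose_sub, conjTranspose_mul, hA.inv.isHermitian.eq, hC.isHermitian.eq]
    simp
  rw [hadj] at key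
  suffices h : t ^ 2 • C⁻¹ - (2 * t) • A⁻¹ + A⁻¹ * C * A⁻¹ =
      (t • 1 - A⁻¹ * C) * C⁻¹ * (t • 1 - C * A⁻¹) from h ▸ key
  have h₁ : A⁻¹ * C * C⁻¹ = A⁻¹ := mul_nonsing_inv_cancel_right C A⁻¹ hC_unit
  have h₂ : C⁻¹ * (C * A⁻¹) = A⁻¹ := nonsing_inv_mul_cancel_left C A⁻¹ hC_unit
  simp only [sub_mul, mul_sub, smul_mul_assoc, mul_smul_comm, one_mul, mul_one, h₁, h₂,
    smul_sub, smul_smul, mul_assoc]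
  module

/-- Weighted operator convexity of the inverse. -/
theorem Matrix.PosDef.posSemidef_smul_inv_add_smul_inv_sub_inv_add
    {n : Type*} [Fintype n] [DecidableEq n]
    {C D : Matrix n n ℝ} (hC : C.PosDef) (hD : D.PosDef) {t s : ℝ} (hts : t + s = 1) :
    (t ^ 2 • C⁻¹ + s ^ 2 • D⁻¹ - (C + D)⁻¹).PosSemidef := by
  have hA := hC.add hD
  have hA_unit : IsUnit (C + D).det := (Matrix.isUnit_iff_isUnit_det _).mp hA.isUnit
  convert (hA.posSemidef_smul_inv_add hC t).add (hA.posSemidef_smul_inv_add hD s) using 1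
  have h : (C + D)⁻¹ * C * (C + D)⁻¹ = (C + D)⁻¹ - (C + D)⁻¹ * D * (C + D)⁻¹ := by
    rw [eq_sub_iff_add_eq, ← add_mul, ← mul_add, Matrix.nonsing_inv_mul _ hA_unit, one_mul]
  obtain rfl : s = 1 - t := by linarith
  rw [h]
  module


/-- Intermediate claim in the proof of the paper's Lemma A.3: for a monotone
matrix norm `ν`, symmetric positive definite `A, B`, and a scalar `d₂ > 0` with
`C := A - d₂ B` positive definite, if `κ_ν(B) ≤ κ_ν(A)` then `κ_ν(B) ≤ κ_ν(C)`,
where `κ_ν(M) = ν M * ν M⁻¹` is the condition number. -/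
theorem condition_number_monotone_norm_sub
    {n : ℕ} (ν : Matrix (Fin n) (Fin n) ℝ → ℝ)
    -- `ν` is a norm:
    (hν_nonneg : ∀ M, 0 ≤ ν M)
    (hν_def : ∀ M, ν M = 0 → M = 0)
    (hν_homog : ∀ (c : ℝ) M, ν (c • M) = |c| * ν M)
    (hν_tri : ∀ M N, ν (M + N) ≤ ν M + ν N)
    -- `ν` is monotone: `0 ≤ B ≤ A` (Loewner order) implies `ν B ≤ ν A`:
    (hν_mono : ∀ M N : Matrix (Fin n) (Fin n) ℝ,
      M.PosSemidef → (N - M).PosSemidef → ν M ≤ ν N)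
    (A B : Matrix (Fin n) (Fin n) ℝ)
    (hA : A.PosDef) (hB : B.PosDef)
    (d₂ : ℝ) (hd₂ : 0 < d₂)
    (hC : (A - d₂ • B).PosDef)
    (hκ : ν B * ν B⁻¹ ≤ ν A * ν A⁻¹) :
    ν B * ν B⁻¹ ≤ ν (A - d₂ • B) * ν (A - d₂ • B)⁻¹ := by
  by_contra! hlt
  have hB_inv_pos : 0 < ν B⁻¹ := by
    refine (hν_nonneg _).lt_of_ne' fun h => ?_
    rw [h, mul_zero] at hlt
    exact absurd hlt (mul_nonneg (hν_nonneg _) (hν_nonneg _)).not_gt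
  have hD : (d₂ • B).PosDef := hB.smul hd₂
  have hD_inv : (d₂ • B)⁻¹ = d₂⁻¹ • B⁻¹ := by
    have := Matrix.inv_smul' B (Units.mk0 d₂ hd₂.ne') ((Matrix.isUnit_iff_isUnit_det _).mp hB.isUnit)
    simpa [Units.smul_def] using this
  have hνD : ν (d₂ • B) = d₂ * ν B := by rw [hν_homog, abs_of_pos hd₂]
  have hνD_inv : ν (d₂ • B)⁻¹ = d₂⁻¹ * ν B⁻¹ := by
    rw [hD_inv, hν_homog, abs_of_pos (inv_pos.mpr hd₂)]
  have hD_inv_pos : 0 < ν (d₂ • B)⁻¹ := by rw [hνD_inv]; positivity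
  have hκD : ν (d₂ • B) * ν (d₂ • B)⁻¹ = ν B * ν B⁻¹ := by
    rw [hνD, hνD_inv]; field_simp
  rw [← hκD] at hκ hlt
  set C := A - d₂ • B
  set D := d₂ • B
  have hA_eq : C + D = A := sub_add_cancel _ _
  have hA_le : ν A ≤ ν C + ν D := hA_eq ▸ hν_tri C D
  have hsum_pos : 0 < ν C⁻¹ + ν D⁻¹ := add_pos_of_nonneg_of_pos (hν_nonneg _) hD_inv_pos
  have hA_inv_le : ν A⁻¹ ≤ ν C⁻¹ * ν D⁻¹ / (ν C⁻¹ + ν D⁻¹) := by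
    have hts : ν D⁻¹ / (ν C⁻¹ + ν D⁻¹) + ν C⁻¹ / (ν C⁻¹ + ν D⁻¹) = 1 := by
      field_simp; ring
    have hconv := hC.posSemidef_smul_inv_add_smul_inv_sub_inv_add hD hts
    rw [hA_eq] at hconv
    refine (hν_mono _ _ hA.inv.posSemidef hconv).trans ((hν_tri _ _).trans_eq ?_)
    rw [hν_homog, hν_homog, abs_of_nonneg (sq_nonneg _), abs_of_nonneg (sq_nonneg _)]
    field_simp
    ring
  have hκA : ν A * ν A⁻¹ ≤ (ν C + ν D) * (ν C⁻¹ * ν D⁻¹ / (ν C⁻¹ + ν D⁻¹)) :=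
    mul_le_mul hA_le hA_inv_le (hν_nonneg _) (add_nonneg (hν_nonneg _) (hν_nonneg _))
  have hbound := hκ.trans hκA
  rw [← mul_div_assoc, le_div_iff₀ hsum_pos] at hbound
  linarith [mul_lt_mul_of_pos_right hlt hD_inv_pos]
end

section
/- Let α, β : [0,1] → ℝ be continuously differentiable with α(λ)+β(λ) ≠ 0 for all λ, let A₀ and A_h be constant real symmetric n×n matrices, and set M(λ) = -((α(λ)+β(λ))A₀ + β(λ)A_h). Assume M(λ) is invertible for all λ ∈ [0,1], and let Q(λ) be a symmetric n×n matrix for each λ. Define F(λ) = -(1/2)Q(λ)M(λ) + ((α(λ)β̇(λ)-α̇(λ)β(λ))/(2(α(λ)+β(λ)))) M(λ)⁻¹ A_h - ((α̇(λ)+β̇(λ))/(2(α(λ)+β(λ)))) I. Then for every λ ∈ [0,1], F(λ)ᵀM(λ) + M(λ)F(λ) + Ṁ(λ) = -M(λ)Q(λ)M(λ), where Ṁ(λ) = -(α̇(λ)+β̇(λ))A₀ - β̇(λ)A_h is the derivative of M. -/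
open Matrix Set

/-- Algebraic core of the paper's Lemma 2.2: with
`M(λ) = -((α(λ)+β(λ))A₀ + β(λ)A_h)` invertible and
`F(λ) = -(1/2)Q(λ)M(λ) + ((αβ̇-α̇β)/(2(α+β))) M(λ)⁻¹A_h - ((α̇+β̇)/(2(α+β))) I`,
one has `FᵀM + MF + Ṁ = -MQM` on `[0,1]`, where
`Ṁ(λ) = -(α̇+β̇)A₀ - β̇A_h`. -/
theorem lyapunov_identity_general_homotopy
    {n : ℕ} (α β α' β' : ℝ → ℝ)
    (hα : ∀ l ∈ Icc (0:ℝ) 1, HasDerivWithinAt α (α' l) (Icc (0:ℝ) 1) l)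
    (hβ : ∀ l ∈ Icc (0:ℝ) 1, HasDerivWithinAt β (β' l) (Icc (0:ℝ) 1) l)
    (hα' : ContinuousOn α' (Icc (0:ℝ) 1))
    (hβ' : ContinuousOn β' (Icc (0:ℝ) 1))
    (hαβ : ∀ l ∈ Icc (0:ℝ) 1, α l + β l ≠ 0)
    (A₀ Ah : Matrix (Fin n) (Fin n) ℝ)
    (hA₀ : A₀.IsSymm) (hAh : Ah.IsSymm)
    (M : ℝ → Matrix (Fin n) (Fin n) ℝ)
    (hM : ∀ l, M l = -((α l + β l) • A₀ + β l • Ah))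
    (hMinv : ∀ l ∈ Icc (0:ℝ) 1, IsUnit (M l))
    (Q : ℝ → Matrix (Fin n) (Fin n) ℝ)
    (hQ : ∀ l, (Q l).IsSymm)
    (F : ℝ → Matrix (Fin n) (Fin n) ℝ)
    (hF : ∀ l, F l = -((1:ℝ)/2) • (Q l * M l)
      + ((α l * β' l - α' l * β l) / (2 * (α l + β l))) • ((M l)⁻¹ * Ah)
      - ((α' l + β' l) / (2 * (α l + β l))) • (1 : Matrix (Fin n) (Fin n) ℝ))
    (M' : ℝ → Matrix (Fin n) (Fin n) ℝ)
    (hM' : ∀ l, M' l = -((α' l + β' l) • A₀) - β' l • Ah) :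
    ∀ l ∈ Icc (0:ℝ) 1,
      (F l)ᵀ * M l + M l * F l + M' l = -(M l * Q l * M l) := by
  intro l hl
  have hs : α l + β l ≠ 0 := hαβ l hl
  have hMsymm : (M l)ᵀ = M l := by
    simp [hM, hA₀.eq, hAh.eq]
  have hMF : M l * F l = -((1:ℝ)/2) • (M l * Q l * M l)
      + ((α l * β' l - α' l * β l) / (2 * (α l + β l))) • Ah
      - ((α' l + β' l) / (2 * (α l + β l))) • M l := by
    rw [hF, mul_sub, mul_add, mul_smul_comm, mul_smul_comm, mul_smul_comm, mul_one,
      mul_nonsing_inv_cancel_left _ _ ((isUnit_iff_isUnit_det _).mp (hMinv l hl)), mul_assoc]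
  have hMQM : (M l * Q l * M l)ᵀ = M l * Q l * M l := by
    rw [transpose_mul, transpose_mul, hMsymm, (hQ l).eq, mul_assoc]
  have hFM : (F l)ᵀ * M l = M l * F l := by
    calc (F l)ᵀ * M l = (M l * F l)ᵀ := by rw [transpose_mul, hMsymm]
      _ = M l * F l := by
        rw [hMF]
        simp only [transpose_sub, transpose_add, transpose_smul, hMQM, hMsymm, hAh.eq]
  have hcancel : ((α l * β' l - α' l * β l) / (α l + β l)) • Ah
      - ((α' l + β' l) / (α l + β l)) • M l + M' l = 0 := by
    rw [hM, hM']
    match_scalars <;> field_simp <;> ring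
  rw [hFM, hMF]
  rw [← sub_eq_zero, ← hcancel]
  match_scalars <;> field_simp <;> ring
end

section
/- Let α, β : [0,1] → ℝ be continuously differentiable with α(0)=1, β(0)=0 and α(λ)+β(λ) ≠ 0 for all λ, let A₀ and A_h be constant real symmetric n×n matrices, and set M(λ) = -((α(λ)+β(λ))A₀ + β(λ)A_h). Assume M(λ) is invertible for all λ ∈ [0,1], let Q(λ) be a symmetric n×n matrix depending continuously on λ, and define F(λ) = -(1/2)Q(λ)M(λ) + ((αβ̇-α̇β)/(2(α+β)))(λ) M(λ)⁻¹ A_h - ((α̇+β̇)/(2(α+β)))(λ) I. If x̃ : [0,1] → ℝⁿ is differentiable and satisfies dx̃/dλ = F(λ)x̃(λ) with x̃(0) = x̃₀, then V(λ) := x̃(λ)ᵀ M(λ) x̃(λ) is differentiable with dV/dλ = -x̃(λ)ᵀ M(λ)Q(λ)M(λ) x̃(λ) for all λ ∈ [0,1], and V(0) = -x̃₀ᵀ A₀ x̃₀. -/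
open Matrix Set

theorem HasDerivWithinAt.dotProduct {ι : Type*} [Fintype ι] {u v : ℝ → ι → ℝ} {u' v' : ι → ℝ}
    {s : Set ℝ} {t : ℝ} (hu : HasDerivWithinAt u u' s t) (hv : HasDerivWithinAt v v' s t) :
    HasDerivWithinAt (fun r => u r ⬝ᵥ v r) (u' ⬝ᵥ v t + u t ⬝ᵥ v') s t := by
  rw [hasDerivWithinAt_pi] at hu hv
  simp only [_root_.dotProduct, ← Finset.sum_add_distrib]
  exact HasDerivWithinAt.fun_sum fun i (_ : i ∈ Finset.univ) => (hu i).mul (hv i)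

theorem HasDerivWithinAt.const_mulVec {ι κ : Type*} [Fintype ι] [Fintype κ]
    (A : Matrix κ ι ℝ) {v : ℝ → ι → ℝ} {v' : ι → ℝ}
    {s : Set ℝ} {t : ℝ} (hv : HasDerivWithinAt v v' s t) :
    HasDerivWithinAt (fun r => A *ᵥ v r) (A *ᵥ v') s t := by
  rw [hasDerivWithinAt_pi] at hv ⊢
  exact fun i => HasDerivWithinAt.fun_sum fun j _ => (hv j).const_mul (A i j)

theorem Matrix.IsSymm.hasDerivWithinAt_quadForm {ι : Type*} [Fintype ι] {A : Matrix ι ι ℝ}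
    (hA : A.IsSymm) {x : ℝ → ι → ℝ} {x' : ι → ℝ} {s : Set ℝ} {t : ℝ}
    (hx : HasDerivWithinAt x x' s t) :
    HasDerivWithinAt (fun r => x r ⬝ᵥ A *ᵥ x r) (2 * (x t ⬝ᵥ A *ᵥ x')) s t := by
  have h : x' ⬝ᵥ A *ᵥ x t = x t ⬝ᵥ A *ᵥ x' := by
    rw [dotProduct_mulVec, ← mulVec_transpose, hA.eq, dotProduct_comm]
  simpa only [h, two_mul] using hx.dotProduct (hx.const_mulVec A)

/-- Paper's Lemma 2.2: if `x̃` solves `dx̃/dλ = F(λ)x̃` on `[0,1]` with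
`x̃(0) = x̃₀`, where `M(λ) = -((α+β)A₀ + βA_h)` is invertible and `F` is the
particle-flow Jacobian, then `V(λ) = x̃ᵀM x̃` satisfies
`dV/dλ = -x̃ᵀ MQM x̃` and `V(0) = -x̃₀ᵀA₀x̃₀`. -/
theorem lyapunov_function_dynamics
    {n : ℕ} (α β α' β' : ℝ → ℝ)
    (hα : ∀ l ∈ Icc (0:ℝ) 1, HasDerivWithinAt α (α' l) (Icc (0:ℝ) 1) l)
    (hβ : ∀ l ∈ Icc (0:ℝ) 1, HasDerivWithinAt β (β' l) (Icc (0:ℝ) 1) l)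
    (hα' : ContinuousOn α' (Icc (0:ℝ) 1))
    (hβ' : ContinuousOn β' (Icc (0:ℝ) 1))
    (hα0 : α 0 = 1) (hβ0 : β 0 = 0)
    (hαβ : ∀ l ∈ Icc (0:ℝ) 1, α l + β l ≠ 0)
    (A₀ Ah : Matrix (Fin n) (Fin n) ℝ)
    (hA₀ : A₀.IsSymm) (hAh : Ah.IsSymm)
    (M : ℝ → Matrix (Fin n) (Fin n) ℝ)
    (hM : ∀ l, M l = -((α l + β l) • A₀ + β l • Ah))
    (hMinv : ∀ l ∈ Icc (0:ℝ) 1, IsUnit (M l))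
    (Q : ℝ → Matrix (Fin n) (Fin n) ℝ)
    (hQ : ∀ l, (Q l).IsSymm)
    (hQcont : ContinuousOn Q (Icc (0:ℝ) 1))
    (F : ℝ → Matrix (Fin n) (Fin n) ℝ)
    (hF : ∀ l, F l = -((1:ℝ)/2) • (Q l * M l)
      + ((α l * β' l - α' l * β l) / (2 * (α l + β l))) • ((M l)⁻¹ * Ah)
      - ((α' l + β' l) / (2 * (α l + β l))) • (1 : Matrix (Fin n) (Fin n) ℝ))
    (xt : ℝ → (Fin n → ℝ)) (xt₀ : Fin n → ℝ)
    (hxt0 : xt 0 = xt₀)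
    (hxt : ∀ l ∈ Icc (0:ℝ) 1,
      HasDerivWithinAt xt ((F l).mulVec (xt l)) (Icc (0:ℝ) 1) l)
    (V : ℝ → ℝ)
    (hV : ∀ l, V l = xt l ⬝ᵥ (M l).mulVec (xt l)) :
    (∀ l ∈ Icc (0:ℝ) 1,
      HasDerivWithinAt V (-(xt l ⬝ᵥ (M l * Q l * M l).mulVec (xt l)))
        (Icc (0:ℝ) 1) l) ∧
    V 0 = -(xt₀ ⬝ᵥ A₀.mulVec xt₀) := by
  have hquad : ∀ l (u v : Fin n → ℝ), u ⬝ᵥ M l *ᵥ v =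
      -((α l + β l) * (u ⬝ᵥ A₀ *ᵥ v) + β l * (u ⬝ᵥ Ah *ᵥ v)) := by
    intro l u v
    simp only [hM, neg_mulVec, add_mulVec, smul_mulVec, dotProduct_neg, dotProduct_add,
      dotProduct_smul, smul_eq_mul]
  refine ⟨fun l hl => ?_, by rw [hV, hquad, hα0, hβ0, hxt0]; ring⟩
  have hs := hαβ l hl
  have hMF : M l * F l = -((1 : ℝ) / 2) • (M l * Q l * M l)
      + ((α l * β' l - α' l * β l) / (2 * (α l + β l))) • Ah
      - ((α' l + β' l) / (2 * (α l + β l))) • M l := by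
    rw [hF, mul_sub, mul_add, mul_smul_comm, mul_smul_comm, mul_smul_comm, mul_one,
      mul_nonsing_inv_cancel_left _ _ ((isUnit_iff_isUnit_det _).1 (hMinv l hl)), mul_assoc]
  have hflow := congrArg (fun B => xt l ⬝ᵥ B *ᵥ xt l) hMF
  simp only [← mulVec_mulVec _ (M l) (F l), sub_mulVec, add_mulVec, smul_mulVec, dotProduct_sub,
    dotProduct_add, dotProduct_smul, smul_eq_mul] at hflow
  rw [hquad l (xt l) (F l *ᵥ xt l), hquad l (xt l) (xt l)] at hflow
  have hVeq : V = fun r => -((α r + β r) * (xt r ⬝ᵥ A₀ *ᵥ xt r) + β r * (xt r ⬝ᵥ Ah *ᵥ xt r)) :=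
    funext fun r => (hV r).trans (hquad r _ _)
  rw [hVeq]
  refine ((((hα l hl).add (hβ l hl)).mul (hA₀.hasDerivWithinAt_quadForm (hxt l hl))).add
    ((hβ l hl).mul (hAh.hasDerivWithinAt_quadForm (hxt l hl)))).neg.congr_deriv ?_
  simp only [Pi.add_apply]
  field_simp at hflow
  apply mul_left_cancel₀ hs
  linear_combination hflow
end

section
/- Let S, H, Q be real n×n matrices with S symmetric and invertible, H symmetric, and Q symmetric, and let a, ȧ, b, ḃ be real scalars with a + b ≠ 0. Define K₁ = (1/2)Q + ((aḃ - ȧb)/(2(a+b))) S⁻¹ H S⁻¹ - ((ȧ+ḃ)/(2(a+b))) S⁻¹ and K₂ = -((aḃ - ȧb)/(a+b)) S⁻¹. Then K₁ is symmetric, and K₁ and K₂ satisfy the two matrix equations ((aḃ - ȧb)/(a+b)) I = -S K₂ and ((ȧ+ḃ)/(a+b)) I = -S K₁ - S K₁ᵀ - H K₂ᵀ + S Q. -/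
open Matrix

/-- Algebraic core of the paper's Theorem 2.1: with `S` symmetric invertible,
`H`, `Q` symmetric and scalars `a, ȧ, b, ḃ` with `a + b ≠ 0`, the matrices
`K₁ = (1/2)Q + ((aḃ-ȧb)/(2(a+b))) S⁻¹HS⁻¹ - ((ȧ+ḃ)/(2(a+b))) S⁻¹` and
`K₂ = -((aḃ-ȧb)/(a+b)) S⁻¹` are such that `K₁` is symmetric and
`((aḃ-ȧb)/(a+b)) I = -SK₂` and `((ȧ+ḃ)/(a+b)) I = -SK₁ - SK₁ᵀ - HK₂ᵀ + SQ`. -/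
theorem drift_coefficient_equations
    {n : ℕ} (S H Q : Matrix (Fin n) (Fin n) ℝ)
    (hS : S.IsSymm) (hSinv : IsUnit S) (hH : H.IsSymm) (hQ : Q.IsSymm)
    (a da b db : ℝ) (hab : a + b ≠ 0)
    (K₁ K₂ : Matrix (Fin n) (Fin n) ℝ)
    (hK₁ : K₁ = ((1:ℝ)/2) • Q
      + ((a * db - da * b) / (2 * (a + b))) • (S⁻¹ * H * S⁻¹)
      - ((da + db) / (2 * (a + b))) • S⁻¹)
    (hK₂ : K₂ = -((a * db - da * b) / (a + b)) • S⁻¹) :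
    K₁.IsSymm ∧
    ((a * db - da * b) / (a + b)) • (1 : Matrix (Fin n) (Fin n) ℝ)
      = -(S * K₂) ∧
    ((da + db) / (a + b)) • (1 : Matrix (Fin n) (Fin n) ℝ)
      = -(S * K₁) - S * K₁ᵀ - H * K₂ᵀ + S * Q := by
  have hdet : IsUnit S.det := (Matrix.isUnit_iff_isUnit_det S).mp hSinv
  have hSS : S * S⁻¹ = 1 := Matrix.mul_nonsing_inv S hdet
  have hSt : S⁻¹ᵀ = S⁻¹ := by rw [Matrix.transpose_nonsing_inv, hS.eq]
  have hSHS : S * (S⁻¹ * H * S⁻¹) = H * S⁻¹ := by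
    rw [← Matrix.mul_assoc, ← Matrix.mul_assoc, hSS, Matrix.one_mul]
  have hK₁t : K₁ᵀ = K₁ := by
    rw [hK₁]
    simp only [Matrix.transpose_add, Matrix.transpose_sub, Matrix.transpose_smul,
      Matrix.transpose_mul, hSt, hH.eq, hQ.eq, Matrix.mul_assoc]
  refine ⟨hK₁t, ?_, ?_⟩
  · rw [hK₂, Matrix.mul_smul, hSS, neg_smul, neg_neg]
  · rw [hK₁t, hK₁, hK₂, Matrix.transpose_smul, hSt]
    simp only [Matrix.mul_add, Matrix.mul_sub, Matrix.mul_smul, hSS, hSHS]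
    match_scalars <;> field_simp <;> ring
end

section
/- Let A be a constant real symmetric n×n matrix, b ∈ ℝⁿ, c ∈ ℝ, let p : ℝⁿ → ℝ be defined by p(x) = exp((1/2)xᵀAx + bᵀx + c), and let Q be a constant real symmetric n×n matrix with entries Q_{ij}. Then for every x ∈ ℝⁿ, the gradient with respect to x of the function x ↦ (1/(2p(x))) ∑_{i,j} ∂²(p Q_{ij})/∂x_i∂x_j (x) equals A Q (Ax + b). -/
open Matrix

/-- Partial derivative `∂f/∂x_i` of a scalar function on `ℝⁿ`. -/
noncomputable def pderiv' {n : ℕ} (f : (Fin n → ℝ) → ℝ) (i : Fin n)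
    (x : Fin n → ℝ) : ℝ :=
  fderiv ℝ f x (Pi.single i 1)

section GaussianDensity

variable {n : ℕ} (A : Matrix (Fin n) (Fin n) ℝ) (b : Fin n → ℝ) (c : ℝ)

theorem hasFDerivAt_mulVec_add_apply (j : Fin n) (x : Fin n → ℝ) :
    HasFDerivAt (fun y => (A.mulVec y + b) j)
      ((ContinuousLinearMap.proj j).comp A.mulVecLin.toContinuousLinearMap) x :=
  (ContinuousLinearMap.hasFDerivAt
    ((ContinuousLinearMap.proj (R := ℝ) (φ := fun _ : Fin n => ℝ) j).comp
      A.mulVecLin.toContinuousLinearMap)).add_const (b j)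

theorem pderiv'_mulVec_add_apply (j k : Fin n) (x : Fin n → ℝ) :
    pderiv' (fun y => (A.mulVec y + b) j) k x = A j k := by
  rw [pderiv', (hasFDerivAt_mulVec_add_apply A b j x).fderiv]
  simp

theorem pderiv'_mul {f g : (Fin n → ℝ) → ℝ} {x : Fin n → ℝ} (i : Fin n)
    (hf : DifferentiableAt ℝ f x) (hg : DifferentiableAt ℝ g x) :
    pderiv' (fun y => f y * g y) i x = f x * pderiv' g i x + pderiv' f i x * g x := by
  simp [pderiv', fderiv_fun_mul hf hg, mul_comm]

theorem pderiv'_mul_const {f : (Fin n → ℝ) → ℝ} {x : Fin n → ℝ} (i : Fin n)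
    (hf : DifferentiableAt ℝ f x) (q : ℝ) :
    pderiv' (fun y => f y * q) i x = pderiv' f i x * q := by
  rw [pderiv', fderiv_mul_const hf]
  simp [pderiv', mul_comm]

theorem pderiv'_const_mul {f : (Fin n → ℝ) → ℝ} {x : Fin n → ℝ} (i : Fin n)
    (hf : DifferentiableAt ℝ f x) (q : ℝ) :
    pderiv' (fun y => q * f y) i x = q * pderiv' f i x := by
  rw [pderiv', fderiv_const_mul hf]
  simp [pderiv']

theorem pderiv'_sum {ι : Type*} (s : Finset ι) {f : ι → (Fin n → ℝ) → ℝ} {x : Fin n → ℝ}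
    (i : Fin n) (hf : ∀ k ∈ s, DifferentiableAt ℝ (f k) x) :
    pderiv' (fun y => ∑ k ∈ s, f k y) i x = ∑ k ∈ s, pderiv' (f k) i x := by
  simp [pderiv', fderiv_fun_sum hf]

theorem differentiable_mulVec_add_apply (j : Fin n) :
    Differentiable ℝ (fun y => (A.mulVec y + b) j) :=
  fun x => (hasFDerivAt_mulVec_add_apply A b j x).differentiableAt

theorem hasFDerivAt_quadratic (hA : A.IsSymm) (x : Fin n → ℝ) :
    HasFDerivAt (fun y => (1/2) * (y ⬝ᵥ A.mulVec y) + b ⬝ᵥ y + c)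
      (∑ k, (A.mulVec x + b) k •
        ContinuousLinearMap.proj (R := ℝ) (φ := fun _ : Fin n => ℝ) k) x := by
  have hproj (k : Fin n) :=
    (ContinuousLinearMap.proj (R := ℝ) (φ := fun _ : Fin n => ℝ) k).hasFDerivAt (x := x)
  have hmul (k : Fin n) : HasFDerivAt (fun y => A.mulVec y k)
      ((ContinuousLinearMap.proj k).comp A.mulVecLin.toContinuousLinearMap) x := by
    simpa using hasFDerivAt_mulVec_add_apply A 0 k x
  have hquad := HasFDerivAt.fun_sum (u := Finset.univ)
    fun k _ => (hproj k).fun_mul (hmul k)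
  have hlin := HasFDerivAt.fun_sum (u := Finset.univ)
    fun k _ => (hproj k).const_mul (b k)
  refine (((hquad.const_mul (1/2)).add hlin).add_const c).congr_fderiv ?_
  ext v
  have hsymm : x ⬝ᵥ A.mulVec v = v ⬝ᵥ A.mulVec x := by
    rw [dotProduct_mulVec, ← mulVec_transpose, hA.eq, dotProduct_comm]
  simp only [dotProduct] at hsymm
  simp [Finset.sum_add_distrib, mul_add, hsymm, mul_comm]
  ring

variable {A b c} {p : (Fin n → ℝ) → ℝ}

theorem hasFDerivAt_gaussian (hA : A.IsSymm)
    (hp : ∀ x, p x = Real.exp ((1/2) * (x ⬝ᵥ A.mulVec x) + b ⬝ᵥ x + c)) (x : Fin n → ℝ) :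
    HasFDerivAt p (p x • ∑ k, (A.mulVec x + b) k •
      ContinuousLinearMap.proj (R := ℝ) (φ := fun _ : Fin n => ℝ) k) x := by
  rw [hp x, funext hp]
  exact (hasFDerivAt_quadratic A b c hA x).exp

theorem pderiv'_gaussian (hA : A.IsSymm)
    (hp : ∀ x, p x = Real.exp ((1/2) * (x ⬝ᵥ A.mulVec x) + b ⬝ᵥ x + c))
    (i : Fin n) (x : Fin n → ℝ) :
    pderiv' p i x = p x * (A.mulVec x + b) i := by
  simp [pderiv', (hasFDerivAt_gaussian hA hp x).fderiv, Pi.single_apply]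

theorem pderiv'_pderiv'_gaussian_mul_const (hA : A.IsSymm)
    (hp : ∀ x, p x = Real.exp ((1/2) * (x ⬝ᵥ A.mulVec x) + b ⬝ᵥ x + c))
    (q : ℝ) (j k : Fin n) (x : Fin n → ℝ) :
    pderiv' (fun z => pderiv' (fun w => p w * q) j z) k x =
      p x * (q * ((A.mulVec x + b) k * (A.mulVec x + b) j + A j k)) := by
  have hd : Differentiable ℝ p := fun z => (hasFDerivAt_gaussian hA hp z).differentiableAt
  have hv := differentiable_mulVec_add_apply A b j
  simp_rw [pderiv'_mul_const j (hd _), pderiv'_gaussian hA hp]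
  rw [pderiv'_mul_const k ((hd x).fun_mul (hv x)), pderiv'_mul k (hd x) (hv x),
    pderiv'_gaussian hA hp, pderiv'_mulVec_add_apply]
  ring

end GaussianDensity

/-- Identity (a_eqQ) from the proof of the paper's Theorem 2.1: for the
Gaussian-type density `p(x) = exp((1/2)xᵀAx + bᵀx + c)` with `A` symmetric
and a constant symmetric matrix `Q`, the gradient of
`x ↦ (1/(2p(x))) ∑_{i,j} ∂²(p Q_{ij})/∂x_i∂x_j` equals `A Q (Ax + b)`. -/
theorem gradient_of_diffusion_term_gaussian
    {n : ℕ} (A : Matrix (Fin n) (Fin n) ℝ) (hA : A.IsSymm)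
    (b : Fin n → ℝ) (c : ℝ)
    (p : (Fin n → ℝ) → ℝ)
    (hp : ∀ x, p x = Real.exp ((1/2) * (x ⬝ᵥ A.mulVec x) + b ⬝ᵥ x + c))
    (Q : Matrix (Fin n) (Fin n) ℝ) (hQ : Q.IsSymm) :
    ∀ x : Fin n → ℝ,
      (fun i => pderiv'
          (fun y => (1 / (2 * p y)) *
            ∑ k, ∑ j, pderiv' (fun z => pderiv' (fun w => p w * Q k j) j z) k y)
          i x)
        = (A * Q).mulVec (A.mulVec x + b) := by
  intro x
  have hterm : (fun y => (1 / (2 * p y)) *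
      ∑ k, ∑ j, pderiv' (fun z => pderiv' (fun w => p w * Q k j) j z) k y) =
      fun y => (1 / 2) * ∑ k, ∑ j,
        ((A.mulVec y + b) k * (A.mulVec y + b) j + A j k) * Q k j := by
    funext y
    have hpy : p y ≠ 0 := by rw [hp]; exact (Real.exp_pos _).ne'
    simp_rw [pderiv'_pderiv'_gaussian_mul_const hA hp, ← Finset.mul_sum, mul_comm (Q _ _)]
    field_simp
  have hd := fun j => differentiable_mulVec_add_apply A b j x
  have hprod := fun k j => ((hd k).fun_mul (hd j)).add_const (A j k)
  have hpd (i k j : Fin n) :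
      pderiv' (fun y => (A.mulVec y + b) k * (A.mulVec y + b) j + A j k) i x =
        (A.mulVec x + b) k * A j i + A k i * (A.mulVec x + b) j := by
    rw [← pderiv'_mulVec_add_apply A b j i x, ← pderiv'_mulVec_add_apply A b k i x,
      ← pderiv'_mul i (hd k) (hd j), pderiv', fderiv_add_const, pderiv']
  funext i
  rw [hterm, pderiv'_const_mul i
    (.fun_sum fun k _ => .fun_sum fun j _ => (hprod k j).mul_const (Q k j)),
    pderiv'_sum _ i fun k _ => .fun_sum fun j _ => (hprod k j).mul_const (Q k j)]
  simp_rw [pderiv'_sum _ i fun j _ => (hprod _ j).mul_const (Q _ j),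
    pderiv'_mul_const i (hprod _ _), hpd]
  generalize A.mulVec x + b = v
  have hswap : ∑ k, ∑ j, v k * A j i * Q k j = ∑ k, ∑ j, A k i * v j * Q k j := by
    rw [Finset.sum_comm]
    refine Finset.sum_congr rfl fun k _ => Finset.sum_congr rfl fun j _ => ?_
    rw [hQ.apply k j]
    ring
  have hAQ : (A * Q).mulVec v i = ∑ k, ∑ j, A k i * v j * Q k j := by
    rw [← mulVec_mulVec]
    simp only [mulVec, dotProduct, Finset.mul_sum]
    refine Finset.sum_congr rfl fun k _ => Finset.sum_congr rfl fun j _ => ?_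
    rw [hA.apply k i]
    ring
  simp_rw [add_mul, Finset.sum_add_distrib]
  rw [hswap, hAQ]
  ring
end

section
/- Let α, β : [0,1] → ℝ be continuously differentiable with α(λ)+β(λ) ≠ 0 for all λ, let A₀, A_h be constant real symmetric n×n matrices and b₀, b_h ∈ ℝⁿ constant vectors, and suppose S(λ) := (α(λ)+β(λ))A₀ + β(λ)A_h is invertible for every λ ∈ [0,1]. Let Q(λ) be a symmetric n×n matrix depending continuously on λ, and define K₁(λ) = (1/2)Q(λ) + ((αβ̇-α̇β)/(2(α+β)))(λ) S(λ)⁻¹ A_h S(λ)⁻¹ - ((α̇+β̇)/(2(α+β)))(λ) S(λ)⁻¹, K₂(λ) = -((αβ̇-α̇β)/(α+β))(λ) S(λ)⁻¹, F(λ) = K₁(λ)S(λ) + K₂(λ)A_h, b̃(λ) = (α(λ)+β(λ))b₀ + β(λ)b_h, b(λ) = K₁(λ)b̃(λ) + K₂(λ)b_h, and x_μ(λ) = -S(λ)⁻¹ b̃(λ). Then x_μ is differentiable on [0,1] and dx_μ/dλ (λ) = F(λ) x_μ(λ) + b(λ) for all λ ∈ [0,1]. -/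
open Matrix Set

section

attribute [local instance] Matrix.linftyOpNormedRing Matrix.linftyOpNormedAlgebra

/-- The derivative of the solution of a linear system `M l *ᵥ x = v l` with differentiable data. -/
theorem hasDerivWithinAt_inv_mulVec {n : Type*} [Fintype n] [DecidableEq n]
    {M : ℝ → Matrix n n ℝ} {M' : Matrix n n ℝ} {v : ℝ → n → ℝ} {v' : n → ℝ}
    {s : Set ℝ} {l : ℝ} (hM : ∀ i j, HasDerivWithinAt (fun t => M t i j) (M' i j) s l)
    (hv : HasDerivWithinAt v v' s l) (hunit : IsUnit (M l)) :
    HasDerivWithinAt (fun t => (M t)⁻¹ *ᵥ v t)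
      ((M l)⁻¹ *ᵥ (v' - M' *ᵥ ((M l)⁻¹ *ᵥ v l))) s l := by
  have : CompleteSpace (Matrix n n ℝ) := FiniteDimensional.complete ℝ _
  have hM_mat : HasDerivWithinAt M M' s l :=
    hasDerivWithinAt_pi.2 fun i => hasDerivWithinAt_pi.2 fun j => hM i j
  obtain ⟨u, hu⟩ := hunit
  have hinv : HasDerivWithinAt (fun t => (M t)⁻¹) (-((M l)⁻¹ * M' * (M l)⁻¹)) s l := by
    have h := hasFDerivAt_ringInverse (𝕜 := ℝ) u
    rw [hu] at h
    have h' := h.comp_hasDerivWithinAt l hM_mat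
    simp only [Function.comp_def, ← Matrix.nonsing_inv_eq_ringInverse, ← Ring.inverse_unit, hu,
      _root_.neg_apply, ContinuousLinearMap.mulLeftRight_apply] at h'
    exact h'
  have hentry : ∀ i j, HasDerivWithinAt (fun t => (M t)⁻¹ i j)
      ((-((M l)⁻¹ * M' * (M l)⁻¹)) i j) s l := fun i j =>
    hasDerivWithinAt_pi.1 (hasDerivWithinAt_pi.1 hinv i) j
  have hprod : HasDerivWithinAt (fun t => (M t)⁻¹ *ᵥ v t)
      ((-((M l)⁻¹ * M' * (M l)⁻¹)) *ᵥ v l + (M l)⁻¹ *ᵥ v') s l := by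
    refine hasDerivWithinAt_pi.2 fun i => ?_
    have h := HasDerivWithinAt.fun_sum (u := Finset.univ) fun j _ =>
      (hentry i j).fun_mul (hasDerivWithinAt_pi.1 hv j)
    simpa only [Matrix.mulVec, dotProduct, Pi.add_apply, Finset.sum_add_distrib] using h
  convert hprod using 1
  simp only [Matrix.mulVec_sub, Matrix.neg_mulVec, Matrix.mulVec_mulVec, Matrix.mul_assoc]
  abel

end

/-- From the proof of the paper's Theorem 2.2: the mean
`x_μ(λ) = -S(λ)⁻¹ b̃(λ)` of the Gaussian homotopy density satisfies the mean
evolution equation `dx_μ/dλ = F(λ)x_μ(λ) + b(λ)` of the linear stochastic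
particle flow. -/
theorem homotopy_mean_satisfies_mean_equation
    {n : ℕ} (α β α' β' : ℝ → ℝ)
    (hα : ∀ l ∈ Icc (0:ℝ) 1, HasDerivWithinAt α (α' l) (Icc (0:ℝ) 1) l)
    (hβ : ∀ l ∈ Icc (0:ℝ) 1, HasDerivWithinAt β (β' l) (Icc (0:ℝ) 1) l)
    (hα' : ContinuousOn α' (Icc (0:ℝ) 1))
    (hβ' : ContinuousOn β' (Icc (0:ℝ) 1))
    (hαβ : ∀ l ∈ Icc (0:ℝ) 1, α l + β l ≠ 0)
    (A₀ Ah : Matrix (Fin n) (Fin n) ℝ)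
    (hA₀ : A₀.IsSymm) (hAh : Ah.IsSymm)
    (b₀ bh : Fin n → ℝ)
    (S : ℝ → Matrix (Fin n) (Fin n) ℝ)
    (hS : ∀ l, S l = (α l + β l) • A₀ + β l • Ah)
    (hSinv : ∀ l ∈ Icc (0:ℝ) 1, IsUnit (S l))
    (Q : ℝ → Matrix (Fin n) (Fin n) ℝ)
    (hQ : ∀ l, (Q l).IsSymm)
    (hQcont : ContinuousOn Q (Icc (0:ℝ) 1))
    (K₁ K₂ F : ℝ → Matrix (Fin n) (Fin n) ℝ)
    (hK₁ : ∀ l, K₁ l = ((1:ℝ)/2) • Q l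
      + ((α l * β' l - α' l * β l) / (2 * (α l + β l))) • ((S l)⁻¹ * Ah * (S l)⁻¹)
      - ((α' l + β' l) / (2 * (α l + β l))) • (S l)⁻¹)
    (hK₂ : ∀ l, K₂ l = -((α l * β' l - α' l * β l) / (α l + β l)) • (S l)⁻¹)
    (hF : ∀ l, F l = K₁ l * S l + K₂ l * Ah)
    (bt : ℝ → Fin n → ℝ)
    (hbt : ∀ l, bt l = (α l + β l) • b₀ + β l • bh)
    (b : ℝ → Fin n → ℝ)
    (hb : ∀ l, b l = (K₁ l).mulVec (bt l) + (K₂ l).mulVec bh)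
    (xμ : ℝ → Fin n → ℝ)
    (hxμ : ∀ l, xμ l = -(S l)⁻¹.mulVec (bt l)) :
    ∀ l ∈ Icc (0:ℝ) 1,
      HasDerivWithinAt xμ ((F l).mulVec (xμ l) + b l) (Icc (0:ℝ) 1) l := by
  intro l hl
  have hc := (hα l hl).add (hβ l hl)
  have hSM : ∀ i j, HasDerivWithinAt (fun t => S t i j)
      (((α' l + β' l) • A₀ + β' l • Ah) i j) (Icc (0:ℝ) 1) l := by
    intro i j
    simp only [hS]
    exact (hc.mul_const (A₀ i j)).add ((hβ l hl).mul_const (Ah i j))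
  have hv : HasDerivWithinAt bt ((α' l + β' l) • b₀ + β' l • bh) (Icc (0:ℝ) 1) l := by
    rw [funext hbt]
    exact (hc.smul_const b₀).add ((hβ l hl).smul_const bh)
  have hx := (hasDerivWithinAt_inv_mulVec hSM hv (hSinv l hl)).neg
  have hxfun : xμ = -fun t => (S t)⁻¹ *ᵥ bt t := funext fun t => by simp [hxμ]
  have hne := hαβ l hl
  have hdet := (Matrix.isUnit_iff_isUnit_det _).1 (hSinv l hl)
  set r := (α' l + β' l) / (α l + β l) with hr
  set g := (α l * β' l - α' l * β l) / (α l + β l) with hg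
  have hrc : α' l + β' l = r * (α l + β l) := by rw [hr]; field_simp
  have hgβ : β' l = r * β l + g := by rw [hr, hg]; field_simp; ring
  have hS' : (α' l + β' l) • A₀ + β' l • Ah = r • S l + g • Ah := by
    rw [hS, hrc, hgβ]; module
  have hbt' : (α' l + β' l) • b₀ + β' l • bh = r • bt l + g • bh := by
    rw [hbt, hrc, hgβ]; module
  have hSx : S l *ᵥ xμ l = -bt l := by
    simp [hxμ, Matrix.mulVec_neg, Matrix.mulVec_mulVec, Matrix.mul_nonsing_inv _ hdet]
  have hflow : F l *ᵥ xμ l + b l = -(g • ((S l)⁻¹ *ᵥ (Ah *ᵥ xμ l + bh))) := by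
    rw [hF, hb, Matrix.add_mulVec, ← Matrix.mulVec_mulVec, hSx, ← Matrix.mulVec_mulVec, hK₂]
    simp only [Matrix.mulVec_neg, Matrix.smul_mulVec, Matrix.mulVec_add, ← hg]
    module
  have hinvx : (S l)⁻¹ *ᵥ bt l = -xμ l := by simp [hxμ]
  rw [← hxfun] at hx
  refine hx.congr_deriv ?_
  rw [hflow, ← Matrix.mulVec_smul, hinvx, hS', hbt', Matrix.mulVec_neg, Matrix.add_mulVec,
    Matrix.smul_mulVec, Matrix.smul_mulVec, hSx]
  congr 2
  module
end

section
/- Let α, β : [0,1] → ℝ be continuously differentiable with α(λ)+β(λ) ≠ 0 for all λ, let A₀, A_h be constant real symmetric n×n matrices, and suppose S(λ) := (α(λ)+β(λ))A₀ + β(λ)A_h is invertible for every λ ∈ [0,1]. Let Q(λ) be a symmetric n×n matrix depending continuously on λ, and define K₁(λ) = (1/2)Q(λ) + ((αβ̇-α̇β)/(2(α+β)))(λ) S(λ)⁻¹ A_h S(λ)⁻¹ - ((α̇+β̇)/(2(α+β)))(λ) S(λ)⁻¹, K₂(λ) = -((αβ̇-α̇β)/(α+β))(λ) S(λ)⁻¹,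 F(λ) = K₁(λ)S(λ) + K₂(λ)A_h, and P_μ(λ) = -S(λ)⁻¹. Then P_μ is differentiable on [0,1] and dP_μ/dλ (λ) = F(λ)P_μ(λ) + P_μ(λ)F(λ)ᵀ + Q(λ) for all λ ∈ [0,1]. -/
open Matrix Set

attribute [local instance] Matrix.normedAddCommGroup Matrix.normedSpace

/-- The derivative of a matrix inverse: `(S⁻¹)' = -S⁻¹ S' S⁻¹`. -/
theorem Matrix.hasDerivWithinAt_inv {m : Type*} [Fintype m] [DecidableEq m]
    {S : ℝ → Matrix m m ℝ} {S' : Matrix m m ℝ} {s : Set ℝ} {l : ℝ}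
    (hS : HasDerivWithinAt S S' s l) (hl : l ∈ s) (hunit : ∀ x ∈ s, IsUnit (S x)) :
    HasDerivWithinAt (fun x => (S x)⁻¹) (-((S l)⁻¹ * S' * (S l)⁻¹)) s l := by
  have hdet : ∀ x ∈ s, IsUnit (S x).det := fun x hx => (isUnit_iff_isUnit_det _).mp (hunit x hx)
  have hinv : ContinuousAt (Inv.inv : Matrix m m ℝ → Matrix m m ℝ) (S l) := by
    refine continuousAt_matrix_inv _ ?_
    rw [Ring.inverse_eq_inv']
    exact continuousAt_inv₀ (hdet l hl).ne_zero
  have hcont : Filter.Tendsto (fun x => (S x)⁻¹) (nhdsWithin l (s \ {l})) (nhds (S l)⁻¹) :=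
    hinv.tendsto.comp (hS.continuousWithinAt.mono sdiff_subset)
  refine hasDerivWithinAt_iff_tendsto_slope.mpr ?_
  refine ((hcont.mul (hasDerivWithinAt_iff_tendsto_slope.mp hS)).mul_const (S l)⁻¹).neg.congr' ?_
  filter_upwards [self_mem_nhdsWithin] with x hx
  have hdiff : (S x)⁻¹ - (S l)⁻¹ = -((S x)⁻¹ * (S x - S l) * (S l)⁻¹) := by
    rw [Matrix.mul_sub, Matrix.sub_mul, nonsing_inv_mul _ (hdet x hx.1), Matrix.mul_assoc,
      mul_nonsing_inv _ (hdet l hl), Matrix.one_mul, Matrix.mul_one, neg_sub]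
  simp only [slope_def_module, hdiff, Matrix.mul_smul, Matrix.smul_mul, smul_neg]

/-- From the proof of the paper's Theorem 2.2: the covariance
`P_μ(λ) = -S(λ)⁻¹` of the Gaussian homotopy density satisfies the covariance
evolution equation `dP_μ/dλ = F P_μ + P_μ Fᵀ + Q` of the linear stochastic
particle flow. -/
theorem homotopy_covariance_satisfies_covariance_equation
    {n : ℕ} (α β α' β' : ℝ → ℝ)
    (hα : ∀ l ∈ Icc (0:ℝ) 1, HasDerivWithinAt α (α' l) (Icc (0:ℝ) 1) l)
    (hβ : ∀ l ∈ Icc (0:ℝ) 1, HasDerivWithinAt β (β' l) (Icc (0:ℝ) 1) l)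
    (hα' : ContinuousOn α' (Icc (0:ℝ) 1))
    (hβ' : ContinuousOn β' (Icc (0:ℝ) 1))
    (hαβ : ∀ l ∈ Icc (0:ℝ) 1, α l + β l ≠ 0)
    (A₀ Ah : Matrix (Fin n) (Fin n) ℝ)
    (hA₀ : A₀.IsSymm) (hAh : Ah.IsSymm)
    (S : ℝ → Matrix (Fin n) (Fin n) ℝ)
    (hS : ∀ l, S l = (α l + β l) • A₀ + β l • Ah)
    (hSinv : ∀ l ∈ Icc (0:ℝ) 1, IsUnit (S l))
    (Q : ℝ → Matrix (Fin n) (Fin n) ℝ)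
    (hQ : ∀ l, (Q l).IsSymm)
    (hQcont : ContinuousOn Q (Icc (0:ℝ) 1))
    (K₁ K₂ F : ℝ → Matrix (Fin n) (Fin n) ℝ)
    (hK₁ : ∀ l, K₁ l = ((1:ℝ)/2) • Q l
      + ((α l * β' l - α' l * β l) / (2 * (α l + β l))) • ((S l)⁻¹ * Ah * (S l)⁻¹)
      - ((α' l + β' l) / (2 * (α l + β l))) • (S l)⁻¹)
    (hK₂ : ∀ l, K₂ l = -((α l * β' l - α' l * β l) / (α l + β l)) • (S l)⁻¹)
    (hF : ∀ l, F l = K₁ l * S l + K₂ l * Ah)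
    (Pμ : ℝ → Matrix (Fin n) (Fin n) ℝ)
    (hPμ : ∀ l, Pμ l = -(S l)⁻¹) :
    ∀ l ∈ Icc (0:ℝ) 1,
      HasDerivWithinAt Pμ (F l * Pμ l + Pμ l * (F l)ᵀ + Q l)
        (Icc (0:ℝ) 1) l := by
  intro l hl
  have ha := hαβ l hl
  have hdet : IsUnit (S l).det := (isUnit_iff_isUnit_det _).mp (hSinv l hl)
  have hSsymm : (S l)ᵀ = S l := by
    rw [hS, transpose_add, transpose_smul, transpose_smul, hA₀.eq, hAh.eq]
  have hderiv : HasDerivWithinAt S ((α' l + β' l) • A₀ + β' l • Ah) (Icc (0:ℝ) 1) l := by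
    rw [funext hS]
    exact (((hα l hl).add (hβ l hl)).smul_const A₀).add ((hβ l hl).smul_const Ah)
  have hderiv_eq : (α' l + β' l) • A₀ + β' l • Ah
      = ((α' l + β' l) / (α l + β l)) • S l
        + ((α l * β' l - α' l * β l) / (α l + β l)) • Ah := by
    rw [hS]
    ext i j
    simp only [Matrix.add_apply, Matrix.smul_apply, smul_eq_mul]
    field_simp
    ring
  rw [hderiv_eq] at hderiv
  have hFP : F l * (S l)⁻¹ = K₁ l + K₂ l * Ah * (S l)⁻¹ := by
    rw [hF, Matrix.add_mul, Matrix.mul_assoc, mul_nonsing_inv _ hdet, Matrix.mul_one]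
  have hPF : (S l)⁻¹ * (F l)ᵀ = (K₁ l + K₂ l * Ah * (S l)⁻¹)ᵀ := by
    rw [← hFP, transpose_mul, transpose_nonsing_inv, hSsymm]
  have hrhs : F l * Pμ l + Pμ l * (F l)ᵀ + Q l
      = - -((S l)⁻¹ * (((α' l + β' l) / (α l + β l)) • S l
        + ((α l * β' l - α' l * β l) / (α l + β l)) • Ah) * (S l)⁻¹) := by
    simp only [hPμ, Matrix.mul_neg, Matrix.neg_mul, hFP, hPF, hK₁, hK₂, Matrix.mul_add, Matrix.add_mul,
      Matrix.mul_smul, Matrix.smul_mul, nonsing_inv_mul _ hdet, Matrix.one_mul, transpose_add,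
      transpose_sub, transpose_smul, transpose_mul, transpose_nonsing_inv, hSsymm, hAh.eq,
      (hQ l).eq, Matrix.mul_assoc]
    match_scalars <;> field_simp <;> ring
  rw [hrhs, funext hPμ]
  exact (Matrix.hasDerivWithinAt_inv hderiv hl hSinv).neg
end

section
/- Let ‖·‖_ν be a monotone norm on real n×n matrices and κ_ν(M) = ‖M‖_ν·‖M⁻¹‖_ν the associated condition number. Let P₀ and H be constant real symmetric positive definite n×n matrices with κ_ν(H) ≤ κ_ν(P₀), let μ ≥ 0, and for β ∈ ℝ set M(β) = P₀ + βH. Consider the class C of continuously differentiable functions β : [0,1] → ℝ with β(0)=0, β(1)=1 and M(β(λ)) positive definite for all λ ∈ [0,1], and define J(β) = ∫₀¹ [ (1/2)(β'(λ))² + μ κ_ν(M(β(λ))) ] dλ. If β* ∈ C minimizes J over C, then β*(λ) ≥ 0 for all λ ∈ [0,1]. -/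
open Matrix Set

section MonotoneNorm

variable {ι : Type*} [Fintype ι]

theorem Seminorm.continuous_matrix (p : Seminorm ℝ (Matrix ι ι ℝ)) : Continuous p := by
  let _ : NormedAddCommGroup (Matrix ι ι ℝ) := Matrix.normedAddCommGroup
  let _ : NormedSpace ℝ (Matrix ι ι ℝ) := Matrix.normedSpace
  exact p.convexOn.locallyLipschitz.continuous

variable [DecidableEq ι]

/-- Operator convexity of the inverse on positive definite matrices. -/
theorem Matrix.PosDef.posSemidef_sub_inv_add {A B : Matrix ι ι ℝ} (hA : A.PosDef)
    (hB : B.PosDef) {s t : ℝ} (hst : s + t = 1) :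
    (s ^ 2 • A⁻¹ + t ^ 2 • B⁻¹ - (A + B)⁻¹).PosSemidef := by
  have hAB := hA.add hB
  have hdet {X : Matrix ι ι ℝ} (hX : X.PosDef) : IsUnit X.det :=
    (Matrix.isUnit_iff_isUnit_det X).1 hX.isUnit
  have sandwich {X : Matrix ι ι ℝ} (hX : X.PosDef) (r : ℝ) :
      (r ^ 2 • X⁻¹ - (2 * r) • (A + B)⁻¹ + (A + B)⁻¹ * X * (A + B)⁻¹).PosSemidef := by
    have h := hX.posSemidef.conjTranspose_mul_mul_same (r • X⁻¹ - (A + B)⁻¹)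
    convert h using 1
    rw [Matrix.conjTranspose_sub, Matrix.conjTranspose_smul, hX.inv.isHermitian.eq,
      hAB.inv.isHermitian.eq]
    simp only [sub_mul, mul_sub, smul_mul_assoc, mul_smul_comm, star_trivial,
      Matrix.nonsing_inv_mul _ (hdet hX), Matrix.mul_nonsing_inv_cancel_right _ _ (hdet hX),
      one_mul]
    module
  have hmid : (A + B)⁻¹ * A * (A + B)⁻¹ + (A + B)⁻¹ * B * (A + B)⁻¹ = (A + B)⁻¹ := by
    rw [← add_mul, ← mul_add, Matrix.nonsing_inv_mul _ (hdet hAB), one_mul]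
  convert (sandwich hA s).add (sandwich hB t) using 1
  obtain rfl : t = 1 - s := by linarith
  calc _ = s ^ 2 • A⁻¹ + (1 - s) ^ 2 • B⁻¹ - (2 : ℝ) • (A + B)⁻¹ + (A + B)⁻¹ := by module
    _ = s ^ 2 • A⁻¹ + (1 - s) ^ 2 • B⁻¹ - (2 : ℝ) • (A + B)⁻¹ +
        ((A + B)⁻¹ * A * (A + B)⁻¹ + (A + B)⁻¹ * B * (A + B)⁻¹) := by rw [hmid]
    _ = _ := by module

/-- The condition number associated with a seminorm on matrices. -/
noncomputable def Seminorm.cond (p : Seminorm ℝ (Matrix ι ι ℝ)) (A : Matrix ι ι ℝ) : ℝ :=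
  p A * p A⁻¹

theorem Seminorm.cond_nonneg (p : Seminorm ℝ (Matrix ι ι ℝ)) (A : Matrix ι ι ℝ) :
    0 ≤ p.cond A :=
  mul_nonneg (apply_nonneg p _) (apply_nonneg p _)

theorem Seminorm.cond_smul (p : Seminorm ℝ (Matrix ι ι ℝ)) {A : Matrix ι ι ℝ} (hA : A.PosDef)
    {c : ℝ} (hc : 0 < c) : p.cond (c • A) = p.cond A := by
  have hinv : (c • A)⁻¹ = c⁻¹ • A⁻¹ := by
    refine Matrix.inv_eq_left_inv ?_
    rw [smul_mul_smul_comm, Matrix.nonsing_inv_mul _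
      ((Matrix.isUnit_iff_isUnit_det A).1 hA.isUnit), inv_mul_cancel₀ hc.ne', one_smul]
  rw [Seminorm.cond, Seminorm.cond, hinv, map_smul_eq_mul, map_smul_eq_mul, norm_inv]
  have : ‖c‖ ≠ 0 := norm_ne_zero_iff.2 hc.ne'
  field_simp

theorem Seminorm.continuousOn_cond (p : Seminorm ℝ (Matrix ι ι ℝ)) {M : ℝ → Matrix ι ι ℝ}
    (hM : Continuous M) {S : Set ℝ} (hpos : ∀ l ∈ S, (M l).PosDef) :
    ContinuousOn (fun l => p.cond (M l)) S := by
  intro l hl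
  have hinv : ContinuousAt (fun A : Matrix ι ι ℝ => A⁻¹) (M l) := by
    refine continuousAt_matrix_inv _ ?_
    rw [Ring.inverse_eq_inv']
    exact continuousAt_inv₀ (hpos l hl).det_pos.ne'
  exact (((p.continuous_matrix.comp hM).continuousAt).mul
    (p.continuous_matrix.continuousAt.comp
      (ContinuousAt.comp hinv hM.continuousAt))).continuousWithinAt

theorem Seminorm.cond_add_mul_le {p : Seminorm ℝ (Matrix ι ι ℝ)}
    (hmono : ∀ M N : Matrix ι ι ℝ, M.PosSemidef → (N - M).PosSemidef → p M ≤ p N)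
    {A B : Matrix ι ι ℝ} (hA : A.PosDef) (hB : B.PosDef) :
    p.cond (A + B) * (p A + p B) ≤ p A * p.cond A + p B * p.cond B := by
  have ha := apply_nonneg p A
  have hb := apply_nonneg p B
  obtain hs | hs := (add_nonneg ha hb).eq_or_lt
  · rw [← hs, mul_zero]
    exact add_nonneg (mul_nonneg ha (p.cond_nonneg A)) (mul_nonneg hb (p.cond_nonneg B))
  set s := p A / (p A + p B) with hs_def
  set t := p B / (p A + p B) with ht_def
  have hst : s + t = 1 := by rw [hs_def, ht_def]; field_simp
  have hinv : p (A + B)⁻¹ ≤ s ^ 2 * p A⁻¹ + t ^ 2 * p B⁻¹ :=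
    calc p (A + B)⁻¹ ≤ p (s ^ 2 • A⁻¹ + t ^ 2 • B⁻¹) :=
          hmono _ _ (hA.add hB).inv.posSemidef (hA.posSemidef_sub_inv_add hB hst)
      _ ≤ p (s ^ 2 • A⁻¹) + p (t ^ 2 • B⁻¹) := map_add_le_add p _ _
      _ = _ := by
        rw [map_smul_eq_mul, map_smul_eq_mul, Real.norm_of_nonneg (sq_nonneg s),
          Real.norm_of_nonneg (sq_nonneg t)]
  calc p.cond (A + B) * (p A + p B)
      ≤ (p A + p B) * (s ^ 2 * p A⁻¹ + t ^ 2 * p B⁻¹) * (p A + p B) := by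
        unfold Seminorm.cond
        gcongr
        exact map_add_le_add p A B
    _ = _ := by
        rw [hs_def, ht_def]
        unfold Seminorm.cond
        field_simp

theorem Seminorm.cond_add_le {p : Seminorm ℝ (Matrix ι ι ℝ)}
    (hmono : ∀ M N : Matrix ι ι ℝ, M.PosSemidef → (N - M).PosSemidef → p M ≤ p N)
    {A B : Matrix ι ι ℝ} (hA : A.PosDef) (hB : B.PosDef) (hBA : p.cond B ≤ p.cond A) :
    p.cond (A + B) ≤ p.cond A := by
  have ha := apply_nonneg p A
  have hb := apply_nonneg p B
  obtain hs | hs := (add_nonneg ha hb).eq_or_lt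
  · have h0 : p (A + B) = 0 :=
      le_antisymm ((map_add_le_add p A B).trans hs.ge) (apply_nonneg p _)
    rw [Seminorm.cond, h0, zero_mul]
    exact p.cond_nonneg A
  · refine le_of_mul_le_mul_right ?_ hs
    nlinarith [Seminorm.cond_add_mul_le hmono hA hB, mul_le_mul_of_nonneg_left hBA hb]

theorem Seminorm.cond_add_le_of_cond_le {p : Seminorm ℝ (Matrix ι ι ℝ)}
    (hdef : ∀ M, p M = 0 → M = 0)
    (hmono : ∀ M N : Matrix ι ι ℝ, M.PosSemidef → (N - M).PosSemidef → p M ≤ p N)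
    {A B : Matrix ι ι ℝ} (hA : A.PosDef) (hB : B.PosDef) (hBA : p.cond B ≤ p.cond (A + B)) :
    p.cond (A + B) ≤ p.cond A := by
  obtain _ | _ := isEmpty_or_nonempty ι
  · rw [Subsingleton.elim (A + B) A]
  have ha : 0 < p A := by
    refine (apply_nonneg p A).lt_of_ne' fun h => hA.det_pos.ne' ?_
    rw [hdef A h, Matrix.det_zero]
  refine le_of_mul_le_mul_right ?_ ha
  nlinarith [Seminorm.cond_add_mul_le hmono hA hB,
    mul_le_mul_of_nonneg_left hBA (apply_nonneg p B)]

/-- Below `0` the condition number of `P + x • H` decreases towards `0`. -/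
theorem Seminorm.cond_add_smul_le {p : Seminorm ℝ (Matrix ι ι ℝ)}
    (hdef : ∀ M, p M = 0 → M = 0)
    (hmono : ∀ M N : Matrix ι ι ℝ, M.PosSemidef → (N - M).PosSemidef → p M ≤ p N)
    {P H : Matrix ι ι ℝ} (hH : H.PosDef) (hκ : p.cond H ≤ p.cond P) {x y : ℝ}
    (hx : (P + x • H).PosDef) (hxy : x ≤ y) (hy : y ≤ 0) :
    p.cond (P + y • H) ≤ p.cond (P + x • H) := by
  obtain rfl | hxy := hxy.eq_or_lt
  · rfl
  have hx0 : 0 < -x := by linarith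
  have hP : P = (P + x • H) + (-x) • H := by module
  have hy' : P + y • H = (P + x • H) + (y - x) • H := by module
  have hHx : p.cond H ≤ p.cond (P + x • H) := by
    refine hκ.trans ?_
    conv_lhs => rw [hP]
    refine Seminorm.cond_add_le_of_cond_le hdef hmono hx (hH.smul hx0) ?_
    rwa [p.cond_smul hH hx0, ← hP]
  rw [hy']
  refine Seminorm.cond_add_le hmono hx (hH.smul (sub_pos.2 hxy)) ?_
  rwa [p.cond_smul hH (sub_pos.2 hxy)]

end MonotoneNorm

section Shrink

/-- The identity on `[0, ∞)`, and a contraction towards `0` on `(-∞, 0)`. -/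
noncomputable def shrinkNeg (x : ℝ) : ℝ := x / (1 + max (-x) 0)

theorem shrinkNeg_of_nonneg {x : ℝ} (hx : 0 ≤ x) : shrinkNeg x = x := by
  rw [shrinkNeg, max_eq_right (by linarith), add_zero, div_one]

theorem shrinkNeg_of_nonpos {x : ℝ} (hx : x ≤ 0) : shrinkNeg x = x / (1 - x) := by
  rw [shrinkNeg, max_eq_left (by linarith), ← sub_eq_add_neg]

theorem shrinkNeg_nonpos {x : ℝ} (hx : x ≤ 0) : shrinkNeg x ≤ 0 := by
  rw [shrinkNeg_of_nonpos hx]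
  exact div_nonpos_of_nonpos_of_nonneg hx (by linarith)

theorem lt_shrinkNeg {x : ℝ} (hx : x < 0) : x < shrinkNeg x := by
  rw [shrinkNeg_of_nonpos hx.le, lt_div_iff₀ (by linarith)]
  nlinarith

theorem le_shrinkNeg (x : ℝ) : x ≤ shrinkNeg x := by
  obtain hx | hx := le_or_gt 0 x
  · exact (shrinkNeg_of_nonneg hx).ge
  · exact (lt_shrinkNeg hx).le

theorem hasDerivAt_shrinkNeg (x : ℝ) :
    HasDerivAt shrinkNeg (1 / (1 + max (-x) 0) ^ 2) x := by
  have hneg {x : ℝ} (hx : x ≤ 0) :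
      HasDerivAt (fun y : ℝ => y / (1 - y)) (1 / (1 + max (-x) 0) ^ 2) x := by
    have h1 : 1 - x ≠ 0 := by linarith
    rw [max_eq_left (by linarith), ← sub_eq_add_neg]
    exact ((hasDerivAt_id' x).div ((hasDerivAt_id' x).const_sub 1) h1).congr_deriv (by ring)
  have hpos {x : ℝ} (hx : 0 ≤ x) :
      HasDerivAt (fun y : ℝ => y) (1 / (1 + max (-x) 0) ^ 2) x := by
    rw [max_eq_right (by linarith)]
    simpa using hasDerivAt_id' x
  obtain hx | rfl | hx := lt_trichotomy x 0
  · refine (hneg hx.le).congr_of_eventuallyEq ?_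
    filter_upwards [Iio_mem_nhds hx] with y hy using shrinkNeg_of_nonpos (le_of_lt hy)
  · rw [← hasDerivWithinAt_univ, ← Iic_union_Ici (a := (0 : ℝ))]
    exact ((hneg le_rfl).hasDerivWithinAt.congr (fun y hy => shrinkNeg_of_nonpos hy)
      (shrinkNeg_of_nonpos le_rfl)).union ((hpos le_rfl).hasDerivWithinAt.congr
        (fun y hy => shrinkNeg_of_nonneg hy) (shrinkNeg_of_nonneg le_rfl))
  · refine (hpos hx.le).congr_of_eventuallyEq ?_
    filter_upwards [Ioi_mem_nhds hx] with y hy using shrinkNeg_of_nonneg (le_of_lt hy)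

theorem one_div_sq_mem_Ioc (x : ℝ) : 1 / (1 + max (-x) 0) ^ 2 ∈ Ioc (0 : ℝ) 1 := by
  have h : 0 ≤ max (-x) 0 := le_max_right _ _
  refine ⟨by positivity, ?_⟩
  rw [div_le_one (by positivity)]
  nlinarith

theorem contDiff_shrinkNeg : ContDiff ℝ 1 shrinkNeg := by
  refine contDiff_one_iff_deriv.2 ⟨fun x => (hasDerivAt_shrinkNeg x).differentiableAt, ?_⟩
  rw [funext fun x => (hasDerivAt_shrinkNeg x).deriv]
  refine continuous_const.div (by fun_prop) fun x => ?_
  have h : 0 ≤ max (-x) 0 := le_max_right _ _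
  positivity

end Shrink

/-- Paper's Theorem 3.2: for a monotone matrix norm `ν` with condition number
`κ_ν(M) = ν M · ν M⁻¹`, symmetric positive definite `P₀, H` with
`κ_ν(H) ≤ κ_ν(P₀)`, and `μ ≥ 0`, any minimizer `β*` of
`J(β) = ∫₀¹ [(1/2)(β')² + μ κ_ν(P₀ + βH)] dλ` over continuously differentiable
`β` with `β(0)=0`, `β(1)=1` and `P₀ + β(λ)H` positive definite on `[0,1]`
satisfies `β*(λ) ≥ 0` on `[0,1]`. -/
theorem optimal_homotopy_nonnegative
    {n : ℕ} (ν : Matrix (Fin n) (Fin n) ℝ → ℝ)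
    -- `ν` is a norm:
    (hν_nonneg : ∀ M, 0 ≤ ν M)
    (hν_def : ∀ M, ν M = 0 → M = 0)
    (hν_homog : ∀ (c : ℝ) M, ν (c • M) = |c| * ν M)
    (hν_tri : ∀ M N, ν (M + N) ≤ ν M + ν N)
    -- `ν` is monotone: `0 ≤ B ≤ A` (Loewner order) implies `ν B ≤ ν A`:
    (hν_mono : ∀ M N : Matrix (Fin n) (Fin n) ℝ,
      M.PosSemidef → (N - M).PosSemidef → ν M ≤ ν N)
    (P₀ H : Matrix (Fin n) (Fin n) ℝ)
    (hP₀ : P₀.PosDef) (hH : H.PosDef)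
    (hκ : ν H * ν H⁻¹ ≤ ν P₀ * ν P₀⁻¹)
    (μ : ℝ) (hμ : 0 ≤ μ)
    (inC : (ℝ → ℝ) → Prop)
    (hinC : ∀ γ : ℝ → ℝ, inC γ ↔
      ContDiff ℝ 1 γ ∧ γ 0 = 0 ∧ γ 1 = 1 ∧
        ∀ l ∈ Icc (0:ℝ) 1, (P₀ + γ l • H).PosDef)
    (J : (ℝ → ℝ) → ℝ)
    (hJ : ∀ γ : ℝ → ℝ,
      J γ = ∫ l in (0:ℝ)..1, ((1/2) * (deriv γ l)^2
        + μ * (ν (P₀ + γ l • H) * ν (P₀ + γ l • H)⁻¹)))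
    (βs : ℝ → ℝ) (hβs : inC βs)
    (hmin : ∀ γ : ℝ → ℝ, inC γ → J βs ≤ J γ) :
    ∀ l ∈ Icc (0:ℝ) 1, 0 ≤ βs l := by
  obtain ⟨hC1, h0, h1, hpos⟩ := (hinC βs).1 hβs
  let p : Seminorm ℝ (Matrix (Fin n) (Fin n) ℝ) := Seminorm.of ν hν_tri hν_homog
  have hdiff : Differentiable ℝ βs := hC1.differentiable one_ne_zero
  have hderiv (l : ℝ) := (hasDerivAt_shrinkNeg (βs l)).comp l (hdiff l).hasDerivAt
  have hcond : ∀ l ∈ Icc (0 : ℝ) 1,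
      (P₀ + shrinkNeg (βs l) • H).PosDef ∧
        p.cond (P₀ + shrinkNeg (βs l) • H) ≤ p.cond (P₀ + βs l • H) := by
    intro l hl
    obtain hb | hb := le_or_gt 0 (βs l)
    · rw [shrinkNeg_of_nonneg hb]
      exact ⟨hpos l hl, le_rfl⟩
    · refine ⟨?_, Seminorm.cond_add_smul_le (p := p) hν_def hν_mono hH hκ (hpos l hl)
        (le_shrinkNeg _) (shrinkNeg_nonpos hb.le)⟩
      convert (hpos l hl).add (hH.smul (sub_pos.2 (lt_shrinkNeg hb))) using 1
      module
  have hC1' : ContDiff ℝ 1 (shrinkNeg ∘ βs) := contDiff_shrinkNeg.comp hC1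
  have hinC' : inC (shrinkNeg ∘ βs) := by
    refine (hinC _).2 ⟨hC1', ?_, ?_, fun l hl => (hcond l hl).1⟩
    · rw [Function.comp_apply, h0, shrinkNeg_of_nonneg le_rfl]
    · rw [Function.comp_apply, h1, shrinkNeg_of_nonneg zero_le_one]
  have hcont : ∀ γ : ℝ → ℝ, inC γ → ContinuousOn (fun l => (1/2) * (deriv γ l)^2
      + μ * (ν (P₀ + γ l • H) * ν (P₀ + γ l • H)⁻¹)) (Icc 0 1) := by
    intro γ hγ
    obtain ⟨hγ1, -, -, hγpos⟩ := (hinC γ).1 hγ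
    have hγ0 := hγ1.continuous
    have hM : Continuous fun l => P₀ + γ l • H := by fun_prop
    exact ((continuous_const.mul ((hγ1.continuous_deriv le_rfl).pow 2)).continuousOn).add
      (continuousOn_const.mul (p.continuousOn_cond hM hγpos))
  have hkin (l : ℝ) : (deriv (shrinkNeg ∘ βs) l) ^ 2 ≤ (deriv βs l) ^ 2 := by
    obtain ⟨hd0, hd1⟩ := one_div_sq_mem_Ioc (βs l)
    rw [(hderiv l).deriv, mul_pow]
    exact mul_le_of_le_one_left (sq_nonneg _) (pow_le_one₀ hd0.le hd1)
  have hpot : ∀ l ∈ Icc (0 : ℝ) 1,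
      μ * (ν (P₀ + (shrinkNeg ∘ βs) l • H) * ν (P₀ + (shrinkNeg ∘ βs) l • H)⁻¹) ≤
        μ * (ν (P₀ + βs l • H) * ν (P₀ + βs l • H)⁻¹) :=
    fun l hl => mul_le_mul_of_nonneg_left (hcond l hl).2 hμ
  have heq : ∀ l ∈ Icc (0 : ℝ) 1, deriv (shrinkNeg ∘ βs) l = deriv βs l := by
    intro l hl
    by_contra hne
    refine (hmin _ hinC').not_gt ?_
    rw [hJ, hJ]
    refine intervalIntegral.integral_lt_integral_of_continuousOn_of_le_of_exists_lt one_pos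
      (hcont _ hinC') (hcont _ hβs)
      (fun x hx => ?_) ⟨l, hl, ?_⟩
    · linarith [hkin x, hpot x (Ioc_subset_Icc_self hx)]
    · have hlt : (deriv (shrinkNeg ∘ βs) l) ^ 2 < (deriv βs l) ^ 2 := by
        refine (hkin l).lt_of_ne fun hsq => hne ?_
        obtain ⟨hd0, -⟩ := one_div_sq_mem_Ioc (βs l)
        rw [(hderiv l).deriv] at hsq ⊢
        obtain h | h := sq_eq_sq_iff_eq_or_eq_neg.1 hsq
        · exact h
        · have hz : deriv βs l = 0 := by
            refine (mul_eq_zero (a := 1 / (1 + max (-βs l) 0) ^ 2 + 1).1 ?_).resolve_left ?_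
            · linear_combination h
            · positivity
          rw [hz, mul_zero]
      linarith [hpot l hl]
  have hconst := constant_of_has_deriv_right_zero (f := fun l => shrinkNeg (βs l) - βs l)
    (a := 0) (b := 1) (hC1'.continuous.sub hC1.continuous).continuousOn fun l hl => by
      have h := ((hC1'.differentiable one_ne_zero l).hasDerivAt.sub
        (hdiff l).hasDerivAt).hasDerivWithinAt (s := Ici l)
      rwa [heq l (Ico_subset_Icc_self hl), sub_self] at h
  intro l hl
  by_contra! hb
  have h := hconst l hl
  rw [h0, shrinkNeg_of_nonneg le_rfl] at h
  linarith [lt_shrinkNeg hb]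
end
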